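/- arXiv:0910.2075 — 4 statements merged into one kernel-verified Lean document; each statement's English description precedes it below -/
import Mathlib

section
/- Let m and g be positive integers. The number of numerical semigroups Λ with multiplicity m, genus g, and f(Λ) < 2m is exactly the binomial coefficient C(m−1, 2m−2−g), where C(a,b) is interpreted as 0 unless 0 ≤ b ≤ a. Moreover, these semigroups are exactly the sets {0, m} ∪ S ∪ [2m, ∞) with S ⊆ [m+1, 2m−1] and |S| = 2m−2−g. -/
open Pointwise

/-- A numerical semigroup: a set of nonnegative integers containing `0`,
closed under addition, with finite complement in `ℕ`. -/
def IsNumericalSemigroup (Λ : Set ℕ) : Prop :=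
  0 ∈ Λ ∧ (∀ a ∈ Λ, ∀ b ∈ Λ, a + b ∈ Λ) ∧ (Λᶜ).Finite

/-- The multiplicity `m(Λ)`: the smallest nonzero element of `Λ`. -/
noncomputable def mult (Λ : Set ℕ) : ℕ := sInf {n | n ∈ Λ ∧ n ≠ 0}

/-- The Frobenius number `f(Λ)`: the largest nonnegative integer not in `Λ`. -/
noncomputable def frob (Λ : Set ℕ) : ℕ := sSup Λᶜ

/-- The genus `g(Λ)`: the number of nonnegative integers not in `Λ`. -/
noncomputable def genus (Λ : Set ℕ) : ℕ := Λᶜ.ncard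

/-- Fibonacci numbers indexed by `ℤ`, with `F_n = 0` for `n ≤ 0`,
`F_1 = F_2 = 1`, `F_{n+2} = F_{n+1} + F_n`. -/
def fibZ (n : ℤ) : ℕ := if 0 < n then Nat.fib n.toNat else 0

/-- Binomial coefficient `C(a, b)` for integers, interpreted as `0` unless `0 ≤ b ≤ a`. -/
def chooseZ (a b : ℤ) : ℕ := if 0 ≤ b ∧ b ≤ a then a.toNat.choose b.toNat else 0

/-- `𝒜_k`: the collection of subsets `A ⊆ [0, k-1]` with `0 ∈ A` and `k ∉ A + A`. -/
def AkSet (k : ℕ) : Finset (Finset ℕ) :=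
  (Finset.range k).powerset.filter (fun A => 0 ∈ A ∧ k ∉ A + A)

/-- A numerical semigroup `Λ` (with multiplicity `m = m(Λ)`) has type `(A; k)` if
`f(Λ) = 2m + k` and `Λ ∩ [m, m+k] = A + m`. -/
noncomputable def HasType (Λ : Set ℕ) (k : ℕ) (A : Finset ℕ) : Prop :=
  frob Λ = 2 * mult Λ + k ∧
    Λ ∩ Set.Icc (mult Λ) (mult Λ + k) = (fun a => a + mult Λ) '' (A : Set ℕ)

/-- `t_g`: the number of numerical semigroups of genus `g` with `f < 3m`. -/
noncomputable def tCount (g : ℕ) : ℕ :=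
  {Λ : Set ℕ | IsNumericalSemigroup Λ ∧ genus Λ = g ∧ frob Λ < 3 * mult Λ}.ncard

/-- `n_g`: the number of numerical semigroups of genus `g`. -/
noncomputable def nCount (g : ℕ) : ℕ :=
  {Λ : Set ℕ | IsNumericalSemigroup Λ ∧ genus Λ = g}.ncard


/-- The set `{0, m} ∪ S ∪ [2m, ∞)`. -/
def depthTwoSet (m : ℕ) (S : Set ℕ) : Set ℕ := {0, m} ∪ S ∪ Set.Ici (2 * m)

theorem mem_depthTwoSet {m n : ℕ} {S : Set ℕ} :
    n ∈ depthTwoSet m S ↔ n = 0 ∨ n = m ∨ n ∈ S ∨ 2 * m ≤ n := by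
  simp only [depthTwoSet, Set.mem_union, Set.mem_insert_iff, Set.mem_singleton_iff, Set.mem_Ici]
  tauto

theorem depthTwoSet_inter_Icc {m : ℕ} {S : Set ℕ} (hS : S ⊆ Set.Icc (m + 1) (2 * m - 1)) :
    depthTwoSet m S ∩ Set.Icc (m + 1) (2 * m - 1) = S := by
  ext n
  simp only [Set.mem_inter_iff, mem_depthTwoSet, Set.mem_Icc]
  constructor
  · rintro ⟨h | h | h | h, h1, h2⟩
    · omega
    · omega
    · exact h
    · omega
  · intro h
    exact ⟨Or.inr (Or.inr (Or.inl h)), hS h⟩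

theorem compl_depthTwoSet_subset (m : ℕ) (S : Set ℕ) :
    (depthTwoSet m S)ᶜ ⊆ Set.Iio (2 * m) := by
  intro n hn
  rw [Set.mem_compl_iff, mem_depthTwoSet] at hn
  rw [Set.mem_Iio]
  by_contra h
  exact hn (Or.inr (Or.inr (Or.inr (not_lt.mp h))))

theorem isNumericalSemigroup_depthTwoSet {m : ℕ} {S : Set ℕ}
    (hS : S ⊆ Set.Icc (m + 1) (2 * m - 1)) : IsNumericalSemigroup (depthTwoSet m S) := by
  have key : ∀ a ∈ depthTwoSet m S, a = 0 ∨ m ≤ a := by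
    intro a ha
    rcases mem_depthTwoSet.mp ha with h | h | h | h
    · exact Or.inl h
    · exact Or.inr h.ge
    · have := (hS h).1
      omega
    · omega
  refine ⟨mem_depthTwoSet.mpr (Or.inl rfl), fun a ha b hb => ?_,
    (Set.finite_Iio _).subset (compl_depthTwoSet_subset m S)⟩
  rcases key a ha with rfl | ha'
  · simpa using hb
  rcases key b hb with rfl | hb'
  · simpa using ha
  exact mem_depthTwoSet.mpr (Or.inr (Or.inr (Or.inr (by omega))))

theorem mult_depthTwoSet {m : ℕ} (hm : 0 < m) {S : Set ℕ}
    (hS : S ⊆ Set.Icc (m + 1) (2 * m - 1)) : mult (depthTwoSet m S) = m := by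
  refine IsLeast.csInf_eq ⟨⟨mem_depthTwoSet.mpr (Or.inr (Or.inl rfl)), hm.ne'⟩, ?_⟩
  rintro n ⟨hn, h0⟩
  rcases mem_depthTwoSet.mp hn with h | h | h | h
  · exact absurd h h0
  · exact h.ge
  · have := (hS h).1
    omega
  · omega

theorem frob_depthTwoSet_lt {m : ℕ} (hm : 0 < m) (S : Set ℕ) :
    frob (depthTwoSet m S) < 2 * m := by
  have h : frob (depthTwoSet m S) ≤ 2 * m - 1 := by
    refine csSup_le' fun n hn => ?_
    have := Set.mem_Iio.mp (compl_depthTwoSet_subset m S hn)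
    omega
  omega

theorem genus_depthTwoSet_add_ncard {m : ℕ} (hm : 0 < m) {S : Set ℕ}
    (hS : S ⊆ Set.Icc (m + 1) (2 * m - 1)) :
    genus (depthTwoSet m S) + S.ncard = 2 * m - 2 := by
  have hfin : S.Finite := (Set.finite_Icc _ _).subset hS
  have hdisj : Disjoint (depthTwoSet m S)ᶜ S := by
    rw [Set.disjoint_left]
    intro n hn h
    exact hn (mem_depthTwoSet.mpr (Or.inr (Or.inr (Or.inl h))))
  have hunion : (depthTwoSet m S)ᶜ ∪ S = ↑((Finset.Ico 1 (2 * m)).erase m) := by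
    ext n
    simp only [Set.mem_union, Set.mem_compl_iff, mem_depthTwoSet, Finset.coe_erase,
      Finset.coe_Ico, Set.mem_sdiff, Set.mem_Ico, Set.mem_singleton_iff]
    by_cases h : n ∈ S
    · have := hS h
      rw [Set.mem_Icc] at this
      simp only [h, or_true, true_iff]
      omega
    · simp only [h, false_or, or_false]
      omega
  rw [genus, ← Set.ncard_union_eq hdisj
    ((Set.finite_Iio _).subset (compl_depthTwoSet_subset m S)) hfin, hunion,
    Set.ncard_coe_finset, Finset.card_erase_of_mem (by rw [Finset.mem_Ico]; omega), Nat.card_Ico]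
  omega

theorem IsNumericalSemigroup.eq_depthTwoSet {m : ℕ} (hm : 0 < m) {Λ : Set ℕ}
    (hΛ : IsNumericalSemigroup Λ) (hmult : mult Λ = m) (hfrob : frob Λ < 2 * m) :
    Λ = depthTwoSet m (Λ ∩ Set.Icc (m + 1) (2 * m - 1)) := by
  have hlarge : ∀ n, 2 * m ≤ n → n ∈ Λ := by
    intro n hn
    by_contra h
    have : n ≤ frob Λ := le_csSup hΛ.2.2.bddAbove h
    omega
  have hmem : m ∈ Λ := by
    have hne : {n | n ∈ Λ ∧ n ≠ 0}.Nonempty := ⟨2 * m, hlarge _ le_rfl, by omega⟩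
    have := (Nat.sInf_mem hne).1
    rwa [← hmult]
  have hmin : ∀ n ∈ Λ, n ≠ 0 → m ≤ n := by
    intro n hn h0
    rw [← hmult]
    exact Nat.sInf_le ⟨hn, h0⟩
  ext n
  rw [mem_depthTwoSet, Set.mem_inter_iff, Set.mem_Icc]
  constructor
  · intro hn
    have := hmin n hn
    simp only [hn, true_and]
    omega
  · rintro (rfl | rfl | h | h)
    · exact hΛ.1
    · exact hmem
    · exact h.1
    · exact hlarge n h

theorem isNumericalSemigroup_depth_two_iff {m g : ℕ} (hm : 0 < m) (Λ : Set ℕ) :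
    (IsNumericalSemigroup Λ ∧ mult Λ = m ∧ genus Λ = g ∧ frob Λ < 2 * m) ↔
      ∃ S : Set ℕ, S ⊆ Set.Icc (m + 1) (2 * m - 1) ∧ (S.ncard : ℤ) = 2 * m - 2 - g ∧
        Λ = depthTwoSet m S := by
  constructor
  · rintro ⟨hΛ, hmult, hgenus, hfrob⟩
    have heq := hΛ.eq_depthTwoSet hm hmult hfrob
    refine ⟨_, Set.inter_subset_right, ?_, heq⟩
    have := genus_depthTwoSet_add_ncard hm
      (Set.inter_subset_right : Λ ∩ Set.Icc (m + 1) (2 * m - 1) ⊆ _)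
    rw [← heq, hgenus] at this
    omega
  · rintro ⟨S, hS, hcard, rfl⟩
    have := genus_depthTwoSet_add_ncard hm hS
    exact ⟨isNumericalSemigroup_depthTwoSet hS, mult_depthTwoSet hm hS, by omega,
      frob_depthTwoSet_lt hm S⟩

theorem ncard_image_depthTwoSet (m k : ℕ) :
    {Λ : Set ℕ | ∃ S : Set ℕ, S ⊆ Set.Icc (m + 1) (2 * m - 1) ∧ S.ncard = k ∧
      Λ = depthTwoSet m S}.ncard = (m - 1).choose k := by
  have himage : {Λ : Set ℕ | ∃ S : Set ℕ, S ⊆ Set.Icc (m + 1) (2 * m - 1) ∧ S.ncard = k ∧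
      Λ = depthTwoSet m S} =
      (fun S : Finset ℕ => depthTwoSet m S) ''
        ↑(Finset.powersetCard k (Finset.Icc (m + 1) (2 * m - 1))) := by
    ext Λ
    simp only [Set.mem_ofPred_eq, Set.mem_image, Finset.mem_coe, Finset.mem_powersetCard]
    constructor
    · rintro ⟨S, hS, hcard, rfl⟩
      lift S to Finset ℕ using (Set.finite_Icc _ _).subset hS
      rw [Set.ncard_coe_finset] at hcard
      exact ⟨S, ⟨by rwa [← Finset.coe_Icc, Finset.coe_subset] at hS, hcard⟩, rfl⟩
    · rintro ⟨S, ⟨hS, hcard⟩, rfl⟩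
      exact ⟨S, by rwa [← Finset.coe_Icc, Finset.coe_subset],
        by rwa [Set.ncard_coe_finset], rfl⟩
  rw [himage, Set.InjOn.ncard_image, Set.ncard_coe_finset, Finset.card_powersetCard,
    Nat.card_Icc]
  · congr 1
    omega
  · intro S hS T hT h
    rw [Finset.mem_coe, Finset.mem_powersetCard] at hS hT
    have hS' := hS.1
    have hT' := hT.1
    rw [← Finset.coe_subset, Finset.coe_Icc] at hS' hT'
    rw [← Finset.coe_inj, ← depthTwoSet_inter_Icc hS', ← depthTwoSet_inter_Icc hT']
    exact congrArg (· ∩ Set.Icc (m + 1) (2 * m - 1)) h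

/-- For positive integers `m` and `g`, the numerical semigroups with
multiplicity `m`, genus `g` and `f < 2m` are exactly the sets
`{0, m} ∪ S ∪ [2m, ∞)` with `S ⊆ [m+1, 2m-1]` and `|S| = 2m - 2 - g`, and their
number is exactly `C(m-1, 2m-2-g)`. -/
theorem statement1 (m g : ℕ) (hm : 0 < m) (hg : 0 < g) :
    (∀ Λ : Set ℕ,
      (IsNumericalSemigroup Λ ∧ mult Λ = m ∧ genus Λ = g ∧ frob Λ < 2 * m) ↔
        ∃ S : Set ℕ, S ⊆ Set.Icc (m + 1) (2 * m - 1) ∧ (S.ncard : ℤ) = 2 * m - 2 - g ∧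
          Λ = {0, m} ∪ S ∪ Set.Ici (2 * m)) ∧
    {Λ : Set ℕ | IsNumericalSemigroup Λ ∧ mult Λ = m ∧ genus Λ = g ∧
        frob Λ < 2 * m}.ncard = chooseZ ((m : ℤ) - 1) (2 * (m : ℤ) - 2 - g) := by
  refine ⟨fun Λ => isNumericalSemigroup_depth_two_iff hm Λ, ?_⟩
  simp only [isNumericalSemigroup_depth_two_iff hm]
  by_cases hk : (0 : ℤ) ≤ 2 * m - 2 - g
  · obtain ⟨k, hk'⟩ := Int.eq_ofNat_of_zero_le hk
    simp only [hk', Nat.cast_inj]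
    rw [ncard_image_depthTwoSet, chooseZ]
    have hm' : ((m : ℤ) - 1).toNat = m - 1 := by omega
    split_ifs with h
    · rw [hm', Int.toNat_natCast]
    · exact Nat.choose_eq_zero_of_lt (by omega)
  · rw [chooseZ, if_neg fun h => hk h.1]
    convert Set.ncard_empty (Set ℕ)
    refine Set.eq_empty_of_forall_notMem ?_
    rintro Λ ⟨S, -, hcard, -⟩
    omega
end

section
/- For any positive integer g, the number of numerical semigroups Λ of genus g satisfying f(Λ) < 2m(Λ) is exactly the Fibonacci number F_{g+1}. -/
open Pointwise

/-- The set with gaps `1, …, j` and `s + j + 2` for `s ∈ S`. -/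
def semigroupOfGaps (j : ℕ) (S : Finset ℕ) : Set ℕ :=
  {n | n = 0 ∨ (j < n ∧ ∀ s ∈ S, n ≠ s + j + 2)}

theorem compl_semigroupOfGaps (j : ℕ) (S : Finset ℕ) :
    (semigroupOfGaps j S)ᶜ = ↑(Finset.Icc 1 j ∪ S.image (fun s => s + j + 2)) := by
  ext n
  simp only [semigroupOfGaps, Set.mem_compl_iff, Set.mem_ofPred_eq, Finset.coe_union, Set.mem_union,
    Finset.mem_coe, Finset.mem_Icc, Finset.mem_image]
  constructor
  · intro h
    by_contra! h'
    exact h (by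
      by_cases hn : n = 0
      · exact Or.inl hn
      · exact Or.inr ⟨h'.1 (by omega), fun s hs he => h'.2 s hs he.symm⟩)
  · rintro (h | ⟨s, hs, rfl⟩) (h' | h')
    · omega
    · omega
    · omega
    · exact h'.2 s hs rfl

theorem genus_semigroupOfGaps (j : ℕ) (S : Finset ℕ) :
    genus (semigroupOfGaps j S) = j + S.card := by
  rw [genus, compl_semigroupOfGaps, Set.ncard_coe_finset, Finset.card_union_of_disjoint,
    Finset.card_image_of_injective]
  · simp
  · intro a b h
    simpa using h
  · rw [Finset.disjoint_left]
    intro n hn hn'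
    obtain ⟨s, -, rfl⟩ := Finset.mem_image.1 hn'
    have := Finset.mem_Icc.1 hn
    omega

theorem mult_semigroupOfGaps (j : ℕ) (S : Finset ℕ) : mult (semigroupOfGaps j S) = j + 1 := by
  refine IsLeast.csInf_eq ⟨⟨Or.inr ⟨by omega, fun s _ => by omega⟩, by omega⟩, ?_⟩
  rintro n ⟨h | h, h0⟩
  · exact absurd h h0
  · exact h.1

theorem frob_semigroupOfGaps_lt {j : ℕ} {S : Finset ℕ} (hS : S ⊆ Finset.range j) :
    frob (semigroupOfGaps j S) < 2 * (j + 1) := by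
  refine Nat.lt_of_le_of_lt (csSup_le' (a := 2 * j + 1) ?_) (by omega)
  rw [compl_semigroupOfGaps]
  intro n hn
  rcases Finset.mem_union.1 (Finset.mem_coe.1 hn) with h | h
  · have := Finset.mem_Icc.1 h
    omega
  · obtain ⟨s, hs, rfl⟩ := Finset.mem_image.1 h
    have := Finset.mem_range.1 (hS hs)
    omega

theorem isNumericalSemigroup_semigroupOfGaps {j : ℕ} {S : Finset ℕ} (hS : S ⊆ Finset.range j) :
    IsNumericalSemigroup (semigroupOfGaps j S) := by
  refine ⟨Or.inl rfl, ?_, ?_⟩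
  · rintro a (rfl | ha) b (rfl | hb)
    · exact Or.inl rfl
    · exact Or.inr (by simpa using hb)
    · exact Or.inr (by simpa using ha)
    · refine Or.inr ⟨by omega, fun s hs => ?_⟩
      have := Finset.mem_range.1 (hS hs)
      omega
  · rw [compl_semigroupOfGaps]
    exact Finset.finite_toSet _

theorem semigroupOfGaps_inj {j k : ℕ} {S T : Finset ℕ}
    (h : semigroupOfGaps j S = semigroupOfGaps k T) : j = k ∧ S = T := by
  have hjk : j = k := by
    have := congrArg mult h
    simpa only [mult_semigroupOfGaps, Nat.add_right_cancel_iff] using this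
  subst hjk
  have key (U : Finset ℕ) (s : ℕ) : s + j + 2 ∈ semigroupOfGaps j U ↔ s ∉ U := by
    constructor
    · rintro (h | h) hs
      · omega
      · exact h.2 s hs rfl
    · refine fun hs => Or.inr ⟨by omega, fun t ht he => hs ?_⟩
      rwa [show s = t by omega]
  refine ⟨rfl, Finset.ext fun s => ?_⟩
  rw [← not_iff_not, ← key, ← key, h]

/-- Every numerical semigroup with `f < 2m` has gaps `1, …, m - 1` and some of
`m + 1, …, 2m - 1`. -/
theorem IsNumericalSemigroup.exists_eq_semigroupOfGaps {Λ : Set ℕ} (hΛ : IsNumericalSemigroup Λ)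
    (hf : frob Λ < 2 * mult Λ) :
    ∃ j : ℕ, ∃ S ⊆ Finset.range j, Λ = semigroupOfGaps j S := by
  classical
  obtain ⟨h0, -, hfin⟩ := hΛ
  have hgt {n : ℕ} (hn : 2 * mult Λ ≤ n) : n ∈ Λ := by
    by_contra h
    have : n ≤ frob Λ := le_csSup hfin.bddAbove h
    omega
  have hmem : mult Λ ∈ Λ ∧ mult Λ ≠ 0 :=
    Nat.sInf_mem (s := {n | n ∈ Λ ∧ n ≠ 0}) ⟨2 * mult Λ + 1, hgt (by omega), by omega⟩
  have hmin {n : ℕ} (hn : n ∈ Λ) (hn0 : n ≠ 0) : mult Λ ≤ n := Nat.sInf_le ⟨hn, hn0⟩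
  generalize mult Λ = m at *
  obtain ⟨j, rfl⟩ := Nat.exists_eq_succ_of_ne_zero hmem.2
  refine ⟨j, (Finset.range j).filter (fun s => s + j + 2 ∉ Λ), Finset.filter_subset _ _, ?_⟩
  ext n
  constructor
  · intro hn
    by_cases hn0 : n = 0
    · exact Or.inl hn0
    · refine Or.inr ⟨hmin hn hn0, fun s hs he => (Finset.mem_filter.1 hs).2 (he ▸ hn)⟩
  · rintro (rfl | ⟨hj, hn⟩)
    · exact h0
    · by_contra hnot
      have h1 : n < 2 * (j + 1) := by
        by_contra h
        exact hnot (hgt (by omega))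
      have h2 : n ≠ j + 1 := fun h => hnot (h ▸ hmem.1)
      have h3 : n - (j + 2) + j + 2 = n := by omega
      exact hn (n - (j + 2)) (Finset.mem_filter.2 ⟨Finset.mem_range.2 (by omega), by rwa [h3]⟩)
        h3.symm

/-- For any positive integer `g`, the number of numerical semigroups of
genus `g` with `f(Λ) < 2 m(Λ)` equals the Fibonacci number `F_{g+1}`. -/
theorem statement2 (g : ℕ) (hg : 0 < g) :
    {Λ : Set ℕ | IsNumericalSemigroup Λ ∧ genus Λ = g ∧
      frob Λ < 2 * mult Λ}.ncard = Nat.fib (g + 1) := by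
  have himage : {Λ : Set ℕ | IsNumericalSemigroup Λ ∧ genus Λ = g ∧ frob Λ < 2 * mult Λ} =
      (fun x : (_ : ℕ × ℕ) × Finset ℕ => semigroupOfGaps x.1.1 x.2) ''
        ((Finset.HasAntidiagonal.antidiagonal g).sigma
          fun p => Finset.powersetCard p.2 (Finset.range p.1) :
            Finset ((_ : ℕ × ℕ) × Finset ℕ)) := by
    ext Λ
    simp only [Set.mem_ofPred_eq, Set.mem_image, Finset.mem_coe, Finset.mem_sigma,
      Finset.HasAntidiagonal.mem_antidiagonal, Finset.mem_powersetCard]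
    constructor
    · rintro ⟨hΛ, hgen, hf⟩
      obtain ⟨j, S, hS, rfl⟩ := hΛ.exists_eq_semigroupOfGaps hf
      exact ⟨⟨(j, S.card), S⟩, ⟨by rw [← hgen, genus_semigroupOfGaps], hS, rfl⟩, rfl⟩
    · rintro ⟨⟨⟨j, c⟩, S⟩, ⟨hsum, hS, hc⟩, rfl⟩
      refine ⟨isNumericalSemigroup_semigroupOfGaps hS, ?_, ?_⟩
      · rw [genus_semigroupOfGaps, hc, hsum]
      · rw [mult_semigroupOfGaps]
        exact frob_semigroupOfGaps_lt hS
  rw [himage, Set.InjOn.ncard_image, Set.ncard_coe_finset, Finset.card_sigma,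
    Nat.fib_succ_eq_sum_choose]
  · simp
  · rintro ⟨⟨j, c⟩, S⟩ hx ⟨⟨k, d⟩, T⟩ hy h
    simp only [Finset.mem_coe, Finset.mem_sigma, Finset.HasAntidiagonal.mem_antidiagonal] at hx hy
    obtain ⟨hjk, hST⟩ : j = k ∧ S = T := semigroupOfGaps_inj h
    subst hjk hST
    obtain rfl : c = d := by omega
    rfl
end

section
/- For any positive integer k, the cardinality of 𝒜_k equals 3^⌊(k−1)/2⌋. -/
open Pointwise

theorem mem_AkSet {k : ℕ} {A : Finset ℕ} :
    A ∈ AkSet k ↔ (∀ a ∈ A, a < k) ∧ 0 ∈ A ∧ ∀ a ∈ A, ∀ b ∈ A, a + b ≠ k := by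
  simp [AkSet, Finset.mem_add, Finset.subset_iff]

/-- The choices for a pair `{a, k - a}`: at most one of the two elements is taken. -/
def pairChoices : Finset (Bool × Bool) := {(true, false), (false, true), (false, false)}

theorem mem_pairChoices {p : Bool × Bool} :
    p ∈ pairChoices ↔ ¬(p.1 = true ∧ p.2 = true) := by
  revert p
  decide

/-- The subset of `[0, k - 1]` containing `0` and determined by a choice for each pair
`{i + 1, k - 1 - i}`. -/
def ofPairChoices (k : ℕ) (f : Fin ((k - 1) / 2) → Bool × Bool) : Finset ℕ :=
  (Finset.range k).filter fun a =>
    a = 0 ∨ ∃ i, (a = i.val + 1 ∧ (f i).1 = true) ∨ (a = k - 1 - i.val ∧ (f i).2 = true)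

theorem mem_ofPairChoices {k : ℕ} {f : Fin ((k - 1) / 2) → Bool × Bool} {a : ℕ} :
    a ∈ ofPairChoices k f ↔ a < k ∧
      (a = 0 ∨ ∃ i, (a = i.val + 1 ∧ (f i).1 = true) ∨
        (a = k - 1 - i.val ∧ (f i).2 = true)) := by
  simp [ofPairChoices]

theorem succ_mem_ofPairChoices {k : ℕ} {f : Fin ((k - 1) / 2) → Bool × Bool}
    (i : Fin ((k - 1) / 2)) : i.val + 1 ∈ ofPairChoices k f ↔ (f i).1 = true := by
  rw [mem_ofPairChoices]
  constructor
  · rintro ⟨-, h | ⟨j, ⟨h, hj⟩ | ⟨h, -⟩⟩⟩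
    · omega
    · rwa [Fin.ext (show i.val = j.val by omega)]
    · omega
  · exact fun h => ⟨by omega, .inr ⟨i, .inl ⟨rfl, h⟩⟩⟩

theorem sub_mem_ofPairChoices {k : ℕ} {f : Fin ((k - 1) / 2) → Bool × Bool}
    (i : Fin ((k - 1) / 2)) : k - 1 - i.val ∈ ofPairChoices k f ↔ (f i).2 = true := by
  rw [mem_ofPairChoices]
  constructor
  · rintro ⟨-, h | ⟨j, ⟨h, -⟩ | ⟨h, hj⟩⟩⟩
    · omega
    · omega
    · rwa [Fin.ext (show i.val = j.val by omega)]
  · exact fun h => ⟨by omega, .inr ⟨i, .inr ⟨rfl, h⟩⟩⟩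

theorem ofPairChoices_mem_AkSet {k : ℕ} (hk : 0 < k) {f : Fin ((k - 1) / 2) → Bool × Bool}
    (hf : ∀ i, f i ∈ pairChoices) : ofPairChoices k f ∈ AkSet k := by
  refine mem_AkSet.2 ⟨fun a ha => (mem_ofPairChoices.1 ha).1,
    mem_ofPairChoices.2 ⟨hk, .inl rfl⟩, fun a ha b hb hab => ?_⟩
  obtain ⟨hak, ha⟩ := mem_ofPairChoices.1 ha
  obtain ⟨hbk, hb⟩ := mem_ofPairChoices.1 hb
  rcases ha with ha | ⟨i, ⟨ha, hi⟩ | ⟨ha, hi⟩⟩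
  · omega
  all_goals rcases hb with hb | ⟨j, ⟨hb, hj⟩ | ⟨hb, hj⟩⟩
  any_goals omega
  all_goals
    obtain rfl : i = j := Fin.ext (by omega)
    have := mem_pairChoices.1 (hf i)
    tauto

theorem ofPairChoices_decide_mem {k : ℕ} {A : Finset ℕ} (hA : A ∈ AkSet k) :
    ofPairChoices k (fun i => (decide (i.val + 1 ∈ A), decide (k - 1 - i.val ∈ A))) = A := by
  obtain ⟨hlt, h0, hadd⟩ := mem_AkSet.1 hA
  ext a
  simp only [mem_ofPairChoices, decide_eq_true_eq]
  constructor
  · rintro ⟨-, rfl | ⟨i, ⟨rfl, h⟩ | ⟨rfl, h⟩⟩⟩ <;> assumption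
  · intro ha
    have hak := hlt a ha
    have h2 := hadd a ha a ha
    refine ⟨hak, ?_⟩
    rcases Nat.eq_zero_or_pos a with h | h
    · exact .inl h
    right
    by_cases hm : a - 1 < (k - 1) / 2
    · have e : a = a - 1 + 1 := by omega
      exact ⟨⟨a - 1, hm⟩, .inl ⟨e, e ▸ ha⟩⟩
    · have e : a = k - 1 - (k - 1 - a) := by omega
      exact ⟨⟨k - 1 - a, by omega⟩, .inr ⟨e, e ▸ ha⟩⟩

/-- For any positive integer `k`, `|𝒜_k| = 3^⌊(k-1)/2⌋`. -/
theorem statement3 (k : ℕ) (hk : 0 < k) :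
    (AkSet k).card = 3 ^ ((k - 1) / 2) := by
  have hcard : (Fintype.piFinset fun _ : Fin ((k - 1) / 2) => pairChoices).card =
      3 ^ ((k - 1) / 2) := by
    rw [Fintype.card_piFinset_const, show pairChoices.card = 3 from rfl]
  rw [← hcard]
  refine Finset.card_bij'
    (fun A _ i => (decide (i.val + 1 ∈ A), decide (k - 1 - i.val ∈ A)))
    (fun f _ => ofPairChoices k f) ?_ ?_ ?_ ?_
  · intro A hA
    refine Fintype.mem_piFinset.2 fun i => mem_pairChoices.2 ?_
    simp only [decide_eq_true_eq]
    exact fun h => (mem_AkSet.1 hA).2.2 _ h.1 _ h.2 (by omega)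
  · exact fun f hf => ofPairChoices_mem_AkSet hk (Fintype.mem_piFinset.1 hf)
  · exact fun A hA => ofPairChoices_decide_mem hA
  · intro f _
    funext i
    simp [succ_mem_ofPairChoices, sub_mem_ofPairChoices]
end

section
/- Let m, k, and g be positive integers with m > k, and let A ∈ 𝒜_k. Then the number of numerical semigroups with multiplicity m, type (A; k), and genus g is exactly the binomial coefficient C(m − 1 − |(A + A) ∩ [0, k]|, g + |A| − m − k − 1), where C(a,b) is interpreted as 0 unless 0 ≤ b ≤ a. -/
open Pointwise

/-- The gaps shared by all numerical semigroups with multiplicity `m` and type `(A; k)`. -/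
def forcedGaps (m k : ℕ) (A : Finset ℕ) : Finset ℕ :=
  Finset.Ico 1 m ∪ (Finset.Icc m (m + k) \ A.image (· + m)) ∪ {2 * m + k}

/-- The integers that may or may not be gaps of a numerical semigroup with
multiplicity `m` and type `(A; k)`. -/
def freeGaps (m k : ℕ) (A : Finset ℕ) : Finset ℕ :=
  Finset.Ico (m + k + 1) (2 * m + k) \ ((A + A).filter (fun x => x ≤ k)).image (· + 2 * m)

theorem mem_forcedGaps {m k n : ℕ} {A : Finset ℕ} :
    n ∈ forcedGaps m k A ↔
      (1 ≤ n ∧ n < m) ∨ (m ≤ n ∧ n ≤ m + k ∧ ∀ a ∈ A, a + m ≠ n) ∨ n = 2 * m + k := by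
  simp [forcedGaps]
  tauto

theorem mem_freeGaps {m k n : ℕ} {A : Finset ℕ} :
    n ∈ freeGaps m k A ↔
      m + k + 1 ≤ n ∧ n < 2 * m + k ∧ ∀ a ∈ A, ∀ b ∈ A, a + b + 2 * m ≠ n := by
  simp only [freeGaps, Finset.mem_sdiff, Finset.mem_Ico, and_assoc]
  refine and_congr_right fun _ => and_congr_right fun h =>
    ⟨fun H a ha b hb e => H ?_, fun H hn => ?_⟩
  · exact Finset.mem_image.2
      ⟨a + b, Finset.mem_filter.2 ⟨Finset.add_mem_add ha hb, by omega⟩, e⟩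
  · obtain ⟨x, hx, rfl⟩ := Finset.mem_image.1 hn
    obtain ⟨a, ha, b, hb, rfl⟩ := Finset.mem_add.1 (Finset.mem_filter.1 hx).1
    exact H a ha b hb rfl

theorem card_forcedGaps {m k : ℕ} {A : Finset ℕ} (hmk : k < m) (hA : A ∈ AkSet k) :
    (forcedGaps m k A).card + A.card = m + k + 1 := by
  obtain ⟨h1, -, -⟩ := mem_AkSet.1 hA
  have hsub : A.image (· + m) ⊆ Finset.Icc m (m + k) := by
    intro x hx
    obtain ⟨a, ha, rfl⟩ := Finset.mem_image.1 hx
    have := h1 a ha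
    simp only [Finset.mem_Icc]
    omega
  have hle := Finset.card_le_card hsub
  have hcard : (A.image (· + m)).card = A.card :=
    Finset.card_image_of_injective _ (add_left_injective m)
  rw [forcedGaps, Finset.card_union_of_disjoint, Finset.card_union_of_disjoint,
    Finset.card_sdiff_of_subset hsub, hcard]
  · simp only [Nat.card_Ico, Nat.card_Icc, Finset.card_singleton] at *
    omega
  · rw [Finset.disjoint_left]
    intro x hx
    simp only [Finset.mem_Ico, Finset.mem_sdiff, Finset.mem_Icc] at *
    omega
  · rw [Finset.disjoint_singleton_right]
    simp only [Finset.mem_union, Finset.mem_Ico, Finset.mem_sdiff, Finset.mem_Icc]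
    omega

theorem card_freeGaps {m k : ℕ} {A : Finset ℕ} (hmk : k < m) (hA : A ∈ AkSet k) :
    (freeGaps m k A).card + ((A + A).filter (fun x => x ≤ k)).card + 1 = m := by
  obtain ⟨-, -, h3⟩ := mem_AkSet.1 hA
  have hsub : ((A + A).filter (fun x => x ≤ k)).image (· + 2 * m) ⊆
      Finset.Ico (m + k + 1) (2 * m + k) := by
    intro x hx
    simp only [Finset.mem_image, Finset.mem_filter, Finset.mem_add] at hx
    obtain ⟨_, ⟨⟨a, ha, b, hb, rfl⟩, h⟩, rfl⟩ := hx
    have := h3 a ha b hb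
    simp only [Finset.mem_Ico]
    omega
  have hle := Finset.card_le_card hsub
  have hcard : (((A + A).filter (fun x => x ≤ k)).image (· + 2 * m)).card =
      ((A + A).filter (fun x => x ≤ k)).card :=
    Finset.card_image_of_injective _ (add_left_injective (2 * m))
  rw [freeGaps, Finset.card_sdiff_of_subset hsub]
  simp only [Nat.card_Ico] at *
  omega

theorem disjoint_forcedGaps_freeGaps {m k : ℕ} {A : Finset ℕ} :
    Disjoint (forcedGaps m k A) (freeGaps m k A) := by
  rw [Finset.disjoint_left]
  intro x hx
  rw [mem_forcedGaps] at hx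
  rw [mem_freeGaps]
  omega

theorem isGreatest_frob {Λ : Set ℕ} (hfin : (Λᶜ).Finite) (h : 0 < frob Λ) :
    IsGreatest Λᶜ (frob Λ) := by
  have hne : (Λᶜ).Nonempty := by
    by_contra hc
    rw [Set.not_nonempty_iff_eq_empty] at hc
    simp [frob, hc] at h
  exact ⟨Nat.sSup_mem hne hfin.bddAbove, fun x hx => le_csSup hfin.bddAbove hx⟩

theorem isLeast_mult {Λ : Set ℕ} (h : 0 < mult Λ) :
    IsLeast {n | n ∈ Λ ∧ n ≠ 0} (mult Λ) :=
  ⟨Nat.sInf_mem (Nat.nonempty_of_pos_sInf h), fun _ hx => Nat.sInf_le hx⟩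

theorem exists_gaps_of_hasType {m k : ℕ} {A : Finset ℕ} (hm : 0 < m)
    {Λ : Set ℕ} (hΛ : IsNumericalSemigroup Λ) (hmult : mult Λ = m) (hT : HasType Λ k A) :
    ∃ G ⊆ freeGaps m k A, Λᶜ = ↑(forcedGaps m k A ∪ G) := by
  obtain ⟨h0, hadd, hfin⟩ := hΛ
  obtain ⟨hf, hI⟩ := hT
  have hL := isLeast_mult (hmult ▸ hm)
  have hF := isGreatest_frob hfin (by omega)
  rw [hf] at hF
  rw [hmult] at hL hF hI
  have hmem : ∀ n, m ≤ n → n ≤ m + k → (n ∈ Λ ↔ ∃ a ∈ A, a + m = n) := by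
    intro n h1 h2
    have := Set.ext_iff.1 hI n
    simp only [Set.mem_inter_iff, Set.mem_Icc, Set.mem_image, Finset.mem_coe] at this
    rw [← this]
    exact ⟨fun h => ⟨h, h1, h2⟩, And.left⟩
  have hAm : ∀ a ∈ A, a + m ∈ Λ := by
    intro a ha
    have : a + m ∈ Λ ∩ Set.Icc m (m + k) := hI ▸ ⟨a, ha, rfl⟩
    exact this.1
  have hlow : ∀ n, 1 ≤ n → n < m → n ∉ Λ := fun n h1 h2 h => by
    have := hL.2 ⟨h, by omega⟩
    omega
  have hhigh : ∀ n, n ∉ Λ → n ≤ 2 * m + k := fun n h => hF.2 h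
  classical
  refine ⟨(freeGaps m k A).filter (· ∉ Λ), Finset.filter_subset _ _, ?_⟩
  ext n
  simp only [Set.mem_compl_iff, Finset.mem_coe, Finset.mem_union, Finset.mem_filter,
    mem_forcedGaps, mem_freeGaps]
  constructor
  · intro hn
    have h1 := hhigh n hn
    have h2 : n ≠ 0 := by rintro rfl; exact hn h0
    rcases lt_or_ge n m with h3 | h3
    · exact Or.inl (Or.inl ⟨by omega, h3⟩)
    rcases le_or_gt n (m + k) with h4 | h4
    · refine Or.inl (Or.inr (Or.inl ⟨h3, h4, fun a ha e => hn (e ▸ hAm a ha)⟩))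
    rcases h1.eq_or_lt with h5 | h5
    · exact Or.inl (Or.inr (Or.inr h5))
    · refine Or.inr ⟨⟨h4, h5, fun a ha b hb e => hn ?_⟩, hn⟩
      have := hadd _ (hAm a ha) _ (hAm b hb)
      rwa [show a + m + (b + m) = n by omega] at this
  · rintro ((⟨h1, h2⟩ | ⟨h1, h2, h3⟩ | rfl) | ⟨-, h⟩)
    · exact hlow n h1 h2
    · rw [hmem n h1 h2]
      rintro ⟨a, ha, e⟩
      exact h3 a ha e
    · exact hF.1
    · exact h

theorem hasType_of_gaps {m k : ℕ} {A : Finset ℕ} (hmk : k < m) (hA : A ∈ AkSet k)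
    {Λ : Set ℕ} {G : Finset ℕ} (hG : G ⊆ freeGaps m k A)
    (hΛ : Λᶜ = ↑(forcedGaps m k A ∪ G)) :
    IsNumericalSemigroup Λ ∧ mult Λ = m ∧ HasType Λ k A := by
  obtain ⟨hAlt, hA0, hAk⟩ := mem_AkSet.1 hA
  have hGm : ∀ n ∈ G, m + k + 1 ≤ n ∧ n < 2 * m + k ∧ ∀ a ∈ A, ∀ b ∈ A, a + b + 2 * m ≠ n :=
    fun n hn => mem_freeGaps.1 (hG hn)
  have hmem : ∀ n, n ∉ Λ ↔ ((1 ≤ n ∧ n < m) ∨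
      (m ≤ n ∧ n ≤ m + k ∧ ∀ a ∈ A, a + m ≠ n) ∨ n = 2 * m + k) ∨ n ∈ G := by
    intro n
    rw [← mem_forcedGaps, ← Set.mem_compl_iff, hΛ]
    simp
  have hmΛ : m ∈ Λ := by
    by_contra h
    rcases (hmem m).1 h with (h | ⟨-, -, h⟩ | h) | h
    · omega
    · exact h 0 hA0 (zero_add m)
    · omega
    · have := hGm m h
      omega
  have h0 : 0 ∈ Λ := by
    by_contra h
    rcases (hmem 0).1 h with (h | h | h) | h
    · omega
    · omega
    · omega
    · have := hGm 0 h
      omega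
  have hge : ∀ n ∈ Λ, n ≠ 0 → m ≤ n := by
    intro n hn h
    by_contra hc
    exact (hmem n).2 (Or.inl (Or.inl ⟨by omega, by omega⟩)) hn
  have hmid : ∀ n ∈ Λ, m ≤ n → n ≤ m + k → ∃ a ∈ A, a + m = n := by
    intro n hn h1 h2
    by_contra! hc
    exact (hmem n).2 (Or.inl (Or.inr (Or.inl ⟨h1, h2, hc⟩))) hn
  have hmult : mult Λ = m :=
    IsLeast.csInf_eq ⟨⟨hmΛ, by omega⟩, fun n hn => hge n hn.1 hn.2⟩
  have hfrob : frob Λ = 2 * m + k := by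
    refine IsGreatest.csSup_eq ⟨(hmem _).2 (by simp), fun n hn => ?_⟩
    rcases (hmem n).1 hn with (h | h | h) | h
    · omega
    · omega
    · omega
    · have := hGm n h
      omega
  refine ⟨⟨h0, fun x hx y hy => ?_, hΛ ▸ Finset.finite_toSet _⟩, hmult, ?_, ?_⟩
  · rcases eq_or_ne x 0 with rfl | hx0
    · rwa [zero_add]
    rcases eq_or_ne y 0 with rfl | hy0
    · rwa [add_zero]
    have hxm := hge x hx hx0
    have hym := hge y hy hy0
    by_contra h
    have hle : x + y ≤ 2 * m + k := by
      rcases (hmem _).1 h with (h | h | h) | h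
      · omega
      · omega
      · omega
      · have := hGm _ h
        omega
    obtain ⟨a, ha, rfl⟩ := hmid x hx hxm (by omega)
    obtain ⟨b, hb, rfl⟩ := hmid y hy hym (by omega)
    have hab := hAk a ha b hb
    rcases (hmem _).1 h with (h | h | h) | h
    · omega
    · omega
    · omega
    · exact (hGm _ h).2.2 a ha b hb (by omega)
  · rw [hmult, hfrob]
  · rw [hmult]
    ext n
    simp only [Set.mem_inter_iff, Set.mem_Icc, Set.mem_image, Finset.mem_coe]
    constructor
    · rintro ⟨hn, h1, h2⟩
      exact hmid n hn h1 h2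
    · rintro ⟨a, ha, rfl⟩
      have h1 := hAlt a ha
      refine ⟨?_, by omega, by omega⟩
      by_contra h
      rcases (hmem _).1 h with (h | ⟨-, -, h⟩ | h) | h
      · omega
      · exact h a ha rfl
      · omega
      · have := hGm _ h
        omega

theorem genus_of_gaps {m k : ℕ} {A : Finset ℕ} (hmk : k < m) (hA : A ∈ AkSet k)
    {Λ : Set ℕ} {G : Finset ℕ} (hG : G ⊆ freeGaps m k A)
    (hΛ : Λᶜ = ↑(forcedGaps m k A ∪ G)) :
    genus Λ + A.card = m + k + 1 + G.card := by
  rw [genus, hΛ, Set.ncard_coe_finset, Finset.card_union_of_disjoint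
    (disjoint_forcedGaps_freeGaps.mono_right hG), ← card_forcedGaps hmk hA]
  omega

theorem setOf_hasType_eq_image {m k g : ℕ} {A : Finset ℕ} (hmk : k < m) (hA : A ∈ AkSet k) :
    {Λ : Set ℕ | IsNumericalSemigroup Λ ∧ mult Λ = m ∧ genus Λ = g ∧ HasType Λ k A} =
      (fun G : Finset ℕ => ((forcedGaps m k A ∪ G : Finset ℕ) : Set ℕ)ᶜ) ''
        ((freeGaps m k A).powerset.filter (fun G => m + k + 1 + G.card = g + A.card) :
          Finset (Finset ℕ)) := by
  ext Λ
  simp only [Set.mem_ofPred_eq, Set.mem_image, Finset.coe_filter, Finset.mem_powerset]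
  constructor
  · rintro ⟨hS, hmult, hg, hT⟩
    obtain ⟨G, hG, h⟩ := exists_gaps_of_hasType (by omega) hS hmult hT
    exact ⟨G, ⟨hG, by rw [← hg, genus_of_gaps hmk hA hG h]⟩, by rw [← h, compl_compl]⟩
  · rintro ⟨G, ⟨hG, hc⟩, h⟩
    have h' : Λᶜ = ↑(forcedGaps m k A ∪ G) := by rw [← h, compl_compl]
    obtain ⟨hS, hmult, hT⟩ := hasType_of_gaps hmk hA hG h'
    have := genus_of_gaps hmk hA hG h'
    exact ⟨hS, hmult, by omega, hT⟩

/-- For positive integers `m, k, g` with `m > k` and `A ∈ 𝒜_k`, the number of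
numerical semigroups with multiplicity `m`, type `(A; k)` and genus `g` is exactly
`C(m - 1 - |(A+A) ∩ [0,k]|, g + |A| - m - k - 1)`. -/
theorem statement6 (m k g : ℕ) (hk : 0 < k) (hg : 0 < g) (hmk : k < m)
    (A : Finset ℕ) (hA : A ∈ AkSet k) :
    {Λ : Set ℕ | IsNumericalSemigroup Λ ∧ mult Λ = m ∧ genus Λ = g ∧
        HasType Λ k A}.ncard =
      chooseZ ((m : ℤ) - 1 - ((A + A).filter (fun x => x ≤ k)).card)
        ((g : ℤ) + A.card - m - k - 1) := by
  rw [setOf_hasType_eq_image hmk hA, Set.InjOn.ncard_image, Set.ncard_coe_finset]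
  · have hfree := card_freeGaps hmk hA
    rw [show (m : ℤ) - 1 - ((A + A).filter (fun x => x ≤ k)).card = (freeGaps m k A).card by omega,
      chooseZ]
    split_ifs with h
    · rw [Int.toNat_natCast, ← Finset.card_powersetCard, Finset.powersetCard_eq_filter]
      congr 1
      refine Finset.filter_congr fun G _ => ?_
      omega
    · rw [Finset.card_eq_zero, Finset.filter_eq_empty_iff]
      intro G hG
      have := Finset.card_le_card (Finset.mem_powerset.1 hG)
      omega
  · intro G hG G' hG' h
    simp only [Finset.coe_filter, Finset.mem_powerset, Set.mem_ofPred_eq] at hG hG'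
    rw [compl_inj_iff, Finset.coe_inj] at h
    have hd := disjoint_forcedGaps_freeGaps (m := m) (k := k) (A := A)
    rw [← Finset.union_sdiff_cancel_left (hd.mono_right hG.1), h,
      Finset.union_sdiff_cancel_left (hd.mono_right hG'.1)]
end
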